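/- Let q be odd and 2t ≤ m. For every 1 ≤ k ≤ m and δ ∈ F_q*, writing f_k^δ(A) = A_{11} + ⋯ + A_{k−1,k−1} + δ A_{kk}, the number of symmetric m×m matrices A of rank at most 2t with f_k^δ(A) ≠ 0 is at least the number of symmetric m×m matrices A of rank at most 2t with A_{11} ≠ 0. Consequently, the minimum distance of the code obtained by evaluating linear forms in the matrix entries on all symmetric matrices of rank at most 2t equals the weight of the codeword of X_{11}. -/

import Mathlib

open Matrix

section
set_option linter.unusedSectionVars false
set_option linter.unusedDecidableInType false
variable {F : Type*} [Field F] [Fintype F] [DecidableEq F]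
  {κ : Type*} [Fintype κ] [DecidableEq κ]

/-- The exponential sum `∑ ψ(c · xᵀ D x)` attached to a square matrix. -/
noncomputable def quadSum (ψ : AddChar F ℂ) (c : F)
    (D : Matrix κ κ F) : ℂ :=
  ∑ x : κ → F, ψ (c * (x ⬝ᵥ D *ᵥ x))

/-- The symmetric matrix with corner `a`, border `b` and remaining block `D`. -/
def bordered {F κ : Type*} (a : F) (b : κ → F) (D : Matrix κ κ F) :
    Matrix (Unit ⊕ κ) (Unit ⊕ κ) F :=
  fromBlocks (of fun _ _ => a) (of fun _ j => b j) (of fun i _ => b i) D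

theorem sum_addChar_mul {ψ : AddChar F ℂ} (hψ : ψ.IsPrimitive) (c : F) :
    ∑ a : F, ψ (c * a) = if c = 0 then (Fintype.card F : ℂ) else 0 := by
  have h := AddChar.sum_mulShift c hψ
  simp_rw [mul_comm _ c] at h
  rw [h]
  split_ifs <;> simp

theorem sum_addChar_dotProduct {ψ : AddChar F ℂ}
    (hψ : ψ.IsPrimitive) (w : κ → F) :
    ∑ x : κ → F, ψ (w ⬝ᵥ x) = if w = 0 then (Fintype.card F : ℂ) ^ Fintype.card κ else 0 := by
  split_ifs with h
  · simp [h]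
  · let χ : AddChar (κ → F) ℂ :=
      { toFun := fun x => ψ (w ⬝ᵥ x)
        map_zero_eq_one' := by simp
        map_add_eq_mul' := fun x y => by rw [dotProduct_add, AddChar.map_add_eq_mul] }
    have hχ : χ ≠ 1 := by
      intro h1
      obtain ⟨i, hi⟩ := Function.ne_iff.mp h
      apply hψ hi
      ext a
      have := DFunLike.congr_fun h1 (Pi.single i a)
      simpa [χ] using this
    exact AddChar.sum_eq_zero_of_ne_one hχ

theorem card_ker_mul_rank (D : Matrix κ κ F) :
    (Finset.univ.filter fun x : κ → F => D *ᵥ x = 0).card * Fintype.card F ^ D.rank =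
      Fintype.card F ^ Fintype.card κ := by
  have h1 := LinearMap.finrank_range_add_finrank_ker D.mulVecLin
  have h2 : (Finset.univ.filter fun x : κ → F => D *ᵥ x = 0).card =
      Nat.card (LinearMap.ker D.mulVecLin) := by
    rw [← Fintype.card_subtype, ← Nat.card_eq_fintype_card]
    exact Nat.card_congr (Equiv.subtypeEquivRight fun x => by simp)
  rw [h2, Module.natCard_eq_pow_finrank (K := F), Nat.card_eq_fintype_card, ← pow_add, add_comm]
  rw [Module.finrank_fintype_fun_eq_card] at h1
  rw [← h1, Matrix.rank]

theorem dotProduct_mulVec_comm {D : Matrix κ κ F} (hD : D.IsSymm)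
    (x y : κ → F) : x ⬝ᵥ D *ᵥ y = y ⬝ᵥ D *ᵥ x := by
  rw [dotProduct_mulVec, ← mulVec_transpose, hD.eq, dotProduct_comm]

theorem quadSum_normSq {ψ : AddChar F ℂ} (hψ : ψ.IsPrimitive)
    (h2 : (2 : F) ≠ 0) {c : F} (hc : c ≠ 0) {D : Matrix κ κ F} (hD : D.IsSymm) :
    ‖quadSum ψ c D‖ ^ 2 = (Fintype.card F : ℝ) ^ Fintype.card κ *
      (Finset.univ.filter fun x : κ → F => D *ᵥ x = 0).card := by
  have key : quadSum ψ c D * (starRingEnd ℂ) (quadSum ψ c D) =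
      (Fintype.card F : ℂ) ^ Fintype.card κ *
      (Finset.univ.filter fun x : κ → F => D *ᵥ x = 0).card := by
    have : quadSum ψ c D * (starRingEnd ℂ) (quadSum ψ c D) =
        ∑ y : κ → F, ∑ z : κ → F, ψ (c * (z ⬝ᵥ D *ᵥ z)) * ψ ((2 * c) • (D *ᵥ z) ⬝ᵥ y) := by
      unfold quadSum
      rw [map_sum, Finset.sum_mul_sum, Finset.sum_comm]
      refine Finset.sum_congr rfl fun y _ => ?_
      rw [← Equiv.sum_comp (Equiv.addRight y)]
      refine Finset.sum_congr rfl fun z _ => ?_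
      rw [← AddChar.map_neg_eq_conj, ← AddChar.map_add_eq_mul, ← AddChar.map_add_eq_mul]
      congr 1
      simp only [Equiv.coe_addRight, mulVec_add, add_dotProduct, dotProduct_add, smul_dotProduct,
        smul_eq_mul]
      rw [dotProduct_mulVec_comm hD z y, dotProduct_comm (D *ᵥ z)]
      ring
    rw [this, Finset.sum_comm]
    simp_rw [← Finset.mul_sum, sum_addChar_dotProduct hψ, smul_eq_zero, mul_ite, mul_zero]
    rw [← Finset.sum_filter]
    simp only [mul_eq_zero, h2, hc, false_or]
    rw [Finset.sum_congr rfl (g := fun _ => (Fintype.card F : ℂ) ^ Fintype.card κ)]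
    · simp [mul_comm]
    · intro z hz
      simp [(Finset.mem_filter.mp hz).2]
  rw [Complex.mul_conj, Complex.normSq_eq_norm_sq] at key
  exact_mod_cast key

theorem quadSum_normSq_mul_rank {ψ : AddChar F ℂ} (hψ : ψ.IsPrimitive)
    (h2 : (2 : F) ≠ 0) {c : F} (hc : c ≠ 0) {D : Matrix κ κ F} (hD : D.IsSymm) :
    ‖quadSum ψ c D‖ ^ 2 * (Fintype.card F : ℝ) ^ D.rank =
      ((Fintype.card F : ℝ) ^ Fintype.card κ) ^ 2 := by
  rw [quadSum_normSq hψ h2 hc hD, mul_assoc, pow_two]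
  congr 1
  exact_mod_cast card_ker_mul_rank D

theorem quadSum_bordered (ψ : AddChar F ℂ) (c a : F) (b : κ → F)
    (D : Matrix κ κ F) :
    quadSum ψ c (bordered a b D) =
      ∑ s : F, ∑ x : κ → F, ψ (c * (a * s ^ 2 + 2 * s * (b ⬝ᵥ x) + x ⬝ᵥ D *ᵥ x)) := by
  unfold quadSum
  rw [← (Equiv.sumArrowEquivProdArrow Unit κ F).symm.sum_comp, Fintype.sum_prod_type,
    ← (Equiv.funUnique Unit F).symm.sum_comp]
  refine Finset.sum_congr rfl fun s _ => Finset.sum_congr rfl fun x _ => ?_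
  congr 2
  simp only [bordered, Equiv.sumArrowEquivProdArrow, Equiv.coe_fn_symm_mk, fromBlocks_mulVec,
    dotProduct, Fintype.sum_sum_type]
  simp [mulVec, dotProduct, mul_add, Finset.sum_add_distrib, Finset.mul_sum]
  have h1 : ∑ i, s * (b i * x i) = s * ∑ i, b i * x i := by rw [Finset.mul_sum]
  have h3 : ∑ i, 2 * s * (b i * x i) = 2 * s * ∑ i, b i * x i := by rw [Finset.mul_sum]
  have h4 : ∑ i, x i * (b i * s) = s * ∑ i, b i * x i := by
    rw [Finset.mul_sum]
    exact Finset.sum_congr rfl fun i _ => by ring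
  rw [h1, h3, h4]
  ring

theorem quadSum_bordered_mulVec (ψ : AddChar F ℂ) (c u : F) (y : κ → F)
    {D : Matrix κ κ F} (hD : D.IsSymm) :
    quadSum ψ c (bordered (u + y ⬝ᵥ D *ᵥ y) (D *ᵥ y) D) =
      (∑ s : F, ψ (c * u * s ^ 2)) * quadSum ψ c D := by
  rw [quadSum_bordered, Finset.sum_mul]
  refine Finset.sum_congr rfl fun s _ => ?_
  rw [quadSum, Finset.mul_sum, ← Equiv.sum_comp (Equiv.subRight (s • y))]
  refine Finset.sum_congr rfl fun x _ => ?_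
  rw [← AddChar.map_add_eq_mul]
  congr 1
  simp only [Equiv.subRight_apply, mulVec_sub, sub_dotProduct, dotProduct_sub, mulVec_smul,
    smul_dotProduct, dotProduct_smul, smul_eq_mul]
  rw [dotProduct_comm (D *ᵥ y), dotProduct_comm (D *ᵥ y), dotProduct_mulVec_comm hD y x]
  ring

theorem exists_mulVec_eq_zero_of_notMem_range {D : Matrix κ κ F}
    (hD : D.IsSymm) {b : κ → F} (hb : ∀ y, D *ᵥ y ≠ b) : ∃ z, D *ᵥ z = 0 ∧ b ⬝ᵥ z ≠ 0 := by
  have hb' : b ∉ LinearMap.range D.mulVecLin := by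
    rintro ⟨y, hy⟩
    exact hb y hy
  obtain ⟨f, hf, hle⟩ := Submodule.exists_le_ker_of_notMem hb'
  obtain ⟨z, rfl⟩ := (dotProductEquiv F κ).surjective f
  refine ⟨z, ?_, by simpa [dotProduct_comm] using hf⟩
  rw [← dotProduct_eq_zero_iff]
  intro w
  have : D *ᵥ w ∈ LinearMap.ker (dotProductEquiv F κ z) := hle ⟨w, rfl⟩
  have h3 : z ⬝ᵥ D *ᵥ w = 0 := by simpa using this
  rwa [dotProduct_mulVec_comm hD, dotProduct_comm] at h3

theorem quadSum_bordered_of_notMem_range {ψ : AddChar F ℂ}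
    (hψ : ψ.IsPrimitive) (h2 : (2 : F) ≠ 0) {c : F} (hc : c ≠ 0) (a : F) {D : Matrix κ κ F}
    (hD : D.IsSymm) {b : κ → F} (hb : ∀ y, D *ᵥ y ≠ b) :
    quadSum ψ c (bordered a b D) = quadSum ψ c D := by
  obtain ⟨z, hz, hbz⟩ := exists_mulVec_eq_zero_of_notMem_range hD hb
  rw [quadSum_bordered, Finset.sum_eq_single 0]
  · simp [quadSum]
  · intro s _ hs
    have h4 : ∀ t : F, ∑ x : κ → F, ψ (c * (a * s ^ 2 + 2 * s * (b ⬝ᵥ x) + x ⬝ᵥ D *ᵥ x)) =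
        ψ ((c * (2 * s * (b ⬝ᵥ z))) * t) *
        ∑ x : κ → F, ψ (c * (a * s ^ 2 + 2 * s * (b ⬝ᵥ x) + x ⬝ᵥ D *ᵥ x)) := by
      intro t
      rw [Finset.mul_sum, ← Equiv.sum_comp (Equiv.addRight (t • z))]
      refine Finset.sum_congr rfl fun x _ => ?_
      rw [← AddChar.map_add_eq_mul]
      congr 1
      simp only [Equiv.coe_addRight, mulVec_add, mulVec_smul, hz, smul_zero, add_zero,
        add_dotProduct, dotProduct_add, smul_dotProduct, dotProduct_smul, smul_eq_mul,
        dotProduct_mulVec_comm hD z x, dotProduct_zero]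
      ring
    have h5 := Finset.sum_congr rfl fun t (_ : t ∈ Finset.univ) => h4 t
    rw [← Finset.sum_mul, sum_addChar_mul hψ, if_neg (by simp [hc, h2, hs, hbz]), zero_mul] at h5
    simpa using h5
  · simp

theorem bordered_isSymm {F κ : Type*} {a : F} {b : κ → F} {D : Matrix κ κ F} (hD : D.IsSymm) :
    (bordered a b D).IsSymm := by
  rw [bordered, Matrix.IsSymm, fromBlocks_transpose, hD.eq]
  rfl

theorem norm_sq_sum_addChar_mul_sq {ψ : AddChar F ℂ} (hψ : ψ.IsPrimitive) (h2 : (2 : F) ≠ 0)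
    {v : F} (hv : v ≠ 0) : ‖∑ s : F, ψ (v * s ^ 2)‖ ^ 2 = Fintype.card F := by
  have h := quadSum_normSq_mul_rank hψ h2 hv (isSymm_one : (1 : Matrix Unit Unit F).IsSymm)
  have h3 : quadSum ψ v (1 : Matrix Unit Unit F) = ∑ s : F, ψ (v * s ^ 2) := by
    rw [quadSum, ← (Equiv.funUnique Unit F).symm.sum_comp]
    simp [pow_two]
  rw [h3, rank_one] at h
  have hq : (Fintype.card F : ℝ) ≠ 0 := by simp
  simp only [Fintype.card_unit, pow_one] at h
  exact mul_right_cancel₀ hq (h.trans (pow_two _))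

theorem exists_isPrimitive : ∃ ψ : AddChar F ℂ, ψ.IsPrimitive := by
  obtain ⟨ψ, hψ⟩ := AddChar.exists_apply_ne_zero.mpr (one_ne_zero (α := F))
  refine ⟨ψ, AddChar.IsPrimitive.of_ne_one ?_⟩
  rintro rfl
  simp at hψ

theorem rank_eq_of_quadSum {ψ : AddChar F ℂ} (hψ : ψ.IsPrimitive) (h2 : (2 : F) ≠ 0)
    {B : Matrix (Unit ⊕ κ) (Unit ⊕ κ) F} (hB : B.IsSymm) {D : Matrix κ κ F} (hD : D.IsSymm)
    {k : ℕ} (h : ‖quadSum ψ 1 B‖ ^ 2 = (Fintype.card F : ℝ) ^ k * ‖quadSum ψ 1 D‖ ^ 2)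
    (l : ℕ) (hkl : k + l = 2) : B.rank = D.rank + l := by
  have h3 := quadSum_normSq_mul_rank hψ h2 one_ne_zero hB
  have h4 := quadSum_normSq_mul_rank hψ h2 one_ne_zero hD
  have hq : (1 : ℝ) < Fintype.card F := by exact_mod_cast Fintype.one_lt_card
  have hq0 : (Fintype.card F : ℝ) ≠ 0 := by positivity
  have hD0 : ‖quadSum ψ 1 D‖ ^ 2 ≠ 0 := by
    intro h0
    rw [h0, zero_mul] at h4
    exact pow_ne_zero _ (pow_ne_zero _ hq0) h4.symm
  apply pow_right_injective₀ (by positivity) hq.ne'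
  apply mul_left_cancel₀ (mul_ne_zero (pow_ne_zero k hq0) hD0)
  simp only [Fintype.card_sum, Fintype.card_unit] at h3
  beta_reduce
  rw [← h, h3, pow_add _ D.rank, h]
  calc _ = (Fintype.card F : ℝ) ^ (k + l) * ((Fintype.card F : ℝ) ^ Fintype.card κ) ^ 2 := by
        rw [hkl]; ring
    _ = _ := by rw [← h4]; ring

theorem rank_bordered_of_notMem_range (h2 : (2 : F) ≠ 0)
    (a : F) {D : Matrix κ κ F} (hD : D.IsSymm) {b : κ → F} (hb : ∀ y, D *ᵥ y ≠ b) :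
    (bordered a b D).rank = D.rank + 2 := by
  obtain ⟨ψ, hψ⟩ := exists_isPrimitive (F := F)
  refine rank_eq_of_quadSum hψ h2 (bordered_isSymm hD) hD (k := 0) ?_ 2 (by norm_num)
  rw [quadSum_bordered_of_notMem_range hψ h2 one_ne_zero a hD hb]
  simp

theorem rank_bordered_mulVec (h2 : (2 : F) ≠ 0) (u : F)
    (y : κ → F) {D : Matrix κ κ F} (hD : D.IsSymm) :
    (bordered (u + y ⬝ᵥ D *ᵥ y) (D *ᵥ y) D).rank = D.rank + if u = 0 then 0 else 1 := by
  obtain ⟨ψ, hψ⟩ := exists_isPrimitive (F := F)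
  have h := quadSum_bordered_mulVec ψ 1 u y hD
  split_ifs with hu
  · refine rank_eq_of_quadSum hψ h2 (bordered_isSymm hD) hD (k := 2) ?_ 0 (by norm_num)
    rw [h, norm_mul, mul_pow]
    simp [hu]
  · refine rank_eq_of_quadSum hψ h2 (bordered_isSymm hD) hD (k := 1) ?_ 1 (by norm_num)
    rw [h, norm_mul, mul_pow, norm_sq_sum_addChar_mul_sq hψ h2 (by simpa using hu), pow_one]

/-- Symmetric matrices with entries in `F`. -/
abbrev SymMat (κ F : Type*) := {A : Matrix κ κ F // A.IsSymm}

noncomputable instance : Fintype (SymMat κ F) := Fintype.ofFinite _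

/-- A symmetric matrix indexed by `Unit ⊕ κ` is a corner, a border and a symmetric block. -/
def borderedEquiv (κ F : Type*) : SymMat κ F × (κ → F) × F ≃ SymMat (Unit ⊕ κ) F where
  toFun p := ⟨bordered p.2.2 p.2.1 p.1.1, bordered_isSymm p.1.2⟩
  invFun A := (⟨A.1.toBlocks₂₂, by
    ext i j
    exact A.2.apply _ _⟩, fun j => A.1 (.inl ()) (.inr j), A.1 (.inl ()) (.inl ()))
  left_inv p := by
    simp [bordered]
  right_inv A := by
    ext (i | i) (j | j)
    · simp [bordered]
    · simp [bordered]
    · simpa [bordered] using A.2.apply _ _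
    · simp [bordered, toBlocks₂₂]

theorem sum_symMat_bordered (f : Matrix (Unit ⊕ κ) (Unit ⊕ κ) F → ℂ) :
    ∑ A : SymMat (Unit ⊕ κ) F, f A.1 =
      ∑ D : SymMat κ F, ∑ b : κ → F, ∑ a : F, f (bordered a b D.1) := by
  rw [← Equiv.sum_comp (borderedEquiv κ F), Fintype.sum_prod_type]
  refine Finset.sum_congr rfl fun D _ => ?_
  rw [Fintype.sum_prod_type]
  rfl

theorem card_fiber_mulVec (D : Matrix κ κ F) (y : κ → F) :
    (Finset.univ.filter fun x : κ → F => D *ᵥ x = D *ᵥ y).card =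
      (Finset.univ.filter fun x : κ → F => D *ᵥ x = 0).card := by
  refine Finset.card_bij' (fun x _ => x - y) (fun x _ => x + y) ?_ ?_ ?_ ?_ <;>
    simp +contextual [mulVec_sub, mulVec_add]

theorem sum_comp_mulVec (D : Matrix κ κ F) (H : (κ → F) → ℂ) :
    ∑ b, H b = (Fintype.card F : ℂ) ^ D.rank / (Fintype.card F : ℂ) ^ Fintype.card κ *
        (∑ y, H (D *ᵥ y)) + ∑ b with ∀ y, D *ᵥ y ≠ b, H b := by
  have hq : (Fintype.card F : ℂ) ≠ 0 := by simp
  have hN : ((Finset.univ.filter fun x : κ → F => D *ᵥ x = 0).card : ℂ) *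
      (Fintype.card F : ℂ) ^ D.rank = (Fintype.card F : ℂ) ^ Fintype.card κ := by
    exact_mod_cast card_ker_mul_rank D
  have h1 : ∑ y, H (D *ᵥ y) = ((Finset.univ.filter fun x : κ → F => D *ᵥ x = 0).card : ℂ) *
      ∑ b with ¬ ∀ y, D *ᵥ y ≠ b, H b := by
    rw [← Finset.sum_fiberwise_of_maps_to (t := Finset.univ.filter fun b => ¬ ∀ y, D *ᵥ y ≠ b)
      (g := fun y => D *ᵥ y) (by simp), Finset.mul_sum]
    refine Finset.sum_congr rfl fun b hb => ?_
    obtain ⟨y, rfl⟩ : ∃ y, D *ᵥ y = b := by simpa using hb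
    rw [Finset.sum_congr rfl (g := fun _ => H (D *ᵥ y))
      (fun x hx => by rw [(Finset.mem_filter.mp hx).2]), Finset.sum_const, card_fiber_mulVec,
      nsmul_eq_mul]
  rw [h1, ← mul_assoc, ← hN, div_mul_eq_mul_div, mul_comm, mul_comm _ (Nat.cast _), div_self,
    mul_one, add_comm, Finset.sum_filter_add_sum_filter_not]
  rw [hN]
  exact pow_ne_zero _ hq

theorem card_notMem_range (D : Matrix κ κ F) :
    ((Finset.univ.filter fun b : κ → F => ∀ y, D *ᵥ y ≠ b).card : ℂ) =
      (Fintype.card F : ℂ) ^ Fintype.card κ - (Fintype.card F : ℂ) ^ D.rank := by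
  have hq : (Fintype.card F : ℂ) ≠ 0 := by simp
  have h := sum_comp_mulVec D fun _ => 1
  simp only [Finset.sum_const, Finset.card_univ, Fintype.card_fun, nsmul_eq_mul, mul_one,
    Nat.cast_pow] at h
  rw [div_mul_cancel₀ _ (pow_ne_zero _ hq)] at h
  rw [h]
  ring

/-- Splitting a sum over all borders of `D` according to whether the border lies in the column
space of `D`. -/
theorem sum_border (D : Matrix κ κ F) (G : F → (κ → F) → ℂ) :
    ∑ b, ∑ a, G a b = (Fintype.card F : ℂ) ^ D.rank / (Fintype.card F : ℂ) ^ Fintype.card κ *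
        (∑ y, ∑ u, G (u + y ⬝ᵥ D *ᵥ y) (D *ᵥ y)) + ∑ b with ∀ y, D *ᵥ y ≠ b, ∑ a, G a b := by
  rw [sum_comp_mulVec D]
  congr 2
  refine Finset.sum_congr rfl fun y _ => ?_
  rw [← Equiv.sum_comp (Equiv.addRight (y ⬝ᵥ D *ᵥ y))]
  rfl

theorem sum_border_addChar {ψ : AddChar F ℂ} (hψ : ψ.IsPrimitive) (h2 : (2 : F) ≠ 0) {c : F}
    (hc : c ≠ 0) (R : ℕ) {D : Matrix κ κ F} (hD : D.IsSymm) :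
    (∑ b : κ → F, ∑ a : F, if (bordered a b D).rank ≤ R then ψ (c * a) else 0) =
      if D.rank = R then (Fintype.card F : ℂ) ^ R / (Fintype.card F : ℂ) ^ Fintype.card κ *
        quadSum ψ c D else 0 := by
  have hz : ∑ a, ψ (c * a) = 0 := by rw [sum_addChar_mul hψ, if_neg hc]
  rw [sum_border D, Finset.sum_eq_zero (s := Finset.univ.filter _), add_zero]
  · simp_rw [rank_bordered_mulVec h2 _ _ hD, mul_add, AddChar.map_add_eq_mul]
    have h3 : ∀ y : κ → F, (∑ u, if D.rank + (if u = 0 then 0 else 1) ≤ R then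
        ψ (c * u) * ψ (c * y ⬝ᵥ D *ᵥ y) else 0) =
        if D.rank = R then ψ (c * y ⬝ᵥ D *ᵥ y) else 0 := by
      intro y
      rcases lt_trichotomy D.rank R with h | h | h
      · rw [if_neg h.ne, Finset.sum_congr rfl (g := fun u => ψ (c * u) * ψ (c * y ⬝ᵥ D *ᵥ y)),
          ← Finset.sum_mul, hz, zero_mul]
        intro u _
        rw [if_pos]
        split_ifs <;> omega
      · rw [if_pos h, Finset.sum_eq_single 0]
        · simp [h]
        · intro u _ hu
          simp [h, hu]
        · simp
      · rw [if_neg h.ne']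
        refine Finset.sum_eq_zero fun u _ => ?_
        rw [if_neg]
        omega
    simp_rw [h3]
    split_ifs with h
    · rw [h, quadSum]
    · simp
  · intro b hb
    simp only [rank_bordered_of_notMem_range h2 _ hD (Finset.mem_filter.mp hb).2]
    split_ifs
    · exact hz
    · simp

theorem sum_border_quadSum {ψ : AddChar F ℂ} (hψ : ψ.IsPrimitive) (h2 : (2 : F) ≠ 0) {c : F}
    (hc : c ≠ 0) (e : F) (R : ℕ) {D : Matrix κ κ F} (hD : D.IsSymm) :
    (∑ b : κ → F, ∑ a : F, if (bordered a b D).rank = R then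
        quadSum ψ c (bordered a b D) * ψ (e * a) else 0) =
      (Fintype.card F : ℂ) ^ D.rank / (Fintype.card F : ℂ) ^ Fintype.card κ *
        (quadSum ψ c D * quadSum ψ e D *
          ∑ u, if D.rank + (if u = 0 then 0 else 1) = R then
            (∑ s, ψ (c * u * s ^ 2)) * ψ (e * u) else 0) +
      if D.rank + 2 = R then
        ((Fintype.card F : ℂ) ^ Fintype.card κ - (Fintype.card F : ℂ) ^ D.rank) *
          (quadSum ψ c D * ∑ a, ψ (e * a)) else 0 := by
  rw [sum_border D]
  congr 2
  · simp_rw [rank_bordered_mulVec h2 _ _ hD, quadSum_bordered_mulVec ψ c _ _ hD]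
    have hE : quadSum ψ e D = ∑ y : κ → F, ψ (e * (y ⬝ᵥ D *ᵥ y)) := rfl
    rw [mul_comm (quadSum ψ c D), mul_assoc, hE, Finset.sum_mul]
    refine Finset.sum_congr rfl fun y _ => ?_
    rw [Finset.mul_sum, Finset.mul_sum]
    refine Finset.sum_congr rfl fun u _ => ?_
    rw [mul_add, AddChar.map_add_eq_mul]
    split_ifs <;> ring
  · rw [← card_notMem_range, Finset.sum_congr rfl (g := fun _ : κ → F => if D.rank + 2 = R then
      quadSum ψ c D * ∑ a, ψ (e * a) else 0)]
    · simp
    · intro b hb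
      simp only [rank_bordered_of_notMem_range h2 _ hD (Finset.mem_filter.mp hb).2,
        quadSum_bordered_of_notMem_range hψ h2 hc _ hD (Finset.mem_filter.mp hb).2]
      split_ifs
      · rw [Finset.mul_sum]
      · simp

theorem sum_border_rank (h2 : (2 : F) ≠ 0) (R : ℕ) {D : Matrix κ κ F} (hD : D.IsSymm) :
    (∑ b : κ → F, ∑ a : F, if (bordered a b D).rank = R then (1 : ℂ) else 0) =
      (Fintype.card F : ℂ) ^ D.rank * ((if D.rank = R then 1 else 0) +
        if D.rank + 1 = R then (Fintype.card F : ℂ) - 1 else 0) +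
      if D.rank + 2 = R then
        ((Fintype.card F : ℂ) ^ Fintype.card κ - (Fintype.card F : ℂ) ^ D.rank) *
          (Fintype.card F : ℂ) else 0 := by
  have hq : (Fintype.card F : ℂ) ≠ 0 := by simp
  rw [sum_border D]
  congr 1
  · simp_rw [rank_bordered_mulVec h2 _ _ hD]
    rw [Finset.sum_const, Finset.card_univ, Fintype.card_fun, nsmul_eq_mul, Nat.cast_pow,
      ← mul_assoc, div_mul_cancel₀ _ (pow_ne_zero _ hq)]
    congr 1
    rw [Fintype.sum_eq_add_sum_compl 0]
    congr 1
    · simp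
    · rw [Finset.sum_congr rfl (g := fun _ : F => if D.rank + 1 = R then (1 : ℂ) else 0)]
      · simp [Finset.card_compl, Nat.cast_sub Fintype.card_pos]
      · intro u hu
        simp only [Finset.mem_compl, Finset.mem_singleton] at hu
        simp [hu]
  · rw [← card_notMem_range, Finset.sum_congr rfl (g := fun _ : κ → F => if D.rank + 2 = R then
      (Fintype.card F : ℂ) else 0)]
    · simp
    · intro b hb
      simp only [rank_bordered_of_notMem_range h2 _ hD (Finset.mem_filter.mp hb).2]
      simp

theorem sum_sum_addChar_mul_sq {ψ : AddChar F ℂ} (hψ : ψ.IsPrimitive) (c e : F) :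
    ∑ u, (∑ s, ψ (c * u * s ^ 2)) * ψ (e * u) =
      (Fintype.card F : ℂ) * (Finset.univ.filter fun s : F => c * s ^ 2 + e = 0).card := by
  simp_rw [Finset.sum_mul]
  rw [Finset.sum_comm]
  have h : ∀ s : F, ∑ u, ψ (c * u * s ^ 2) * ψ (e * u) =
      if c * s ^ 2 + e = 0 then (Fintype.card F : ℂ) else 0 := by
    intro s
    rw [← sum_addChar_mul hψ]
    refine Finset.sum_congr rfl fun u _ => ?_
    rw [← AddChar.map_add_eq_mul]
    congr 1
    ring
  simp_rw [h]
  rw [← Finset.sum_filter]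
  simp [mul_comm]

theorem card_filter_mul_sq_add_le {c : F} (hc : c ≠ 0) (e : F) :
    (Finset.univ.filter fun s : F => c * s ^ 2 + e = 0).card ≤ 2 := by
  by_cases h : ∃ s, c * s ^ 2 + e = 0
  · obtain ⟨s, hs⟩ := h
    refine (Finset.card_le_card (t := {s, -s}) ?_).trans Finset.card_le_two
    intro x hx
    have hx' : c * x ^ 2 + e = 0 := by simpa using hx
    have : c * (x ^ 2 - s ^ 2) = 0 := by linear_combination hx' - hs
    simpa [sub_eq_zero, sq_eq_sq_iff_eq_or_eq_neg] using (mul_eq_zero.mp this).resolve_left hc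
  · simp [Finset.filter_eq_empty_iff.mpr fun s _ => not_exists.mp h s]

theorem sum_border_quadSum_zero {ψ : AddChar F ℂ} (hψ : ψ.IsPrimitive) (h2 : (2 : F) ≠ 0) {c : F}
    (hc : c ≠ 0) (R : ℕ) {D : Matrix κ κ F} (hD : D.IsSymm) :
    (∑ b : κ → F, ∑ a : F, if (bordered a b D).rank = R then quadSum ψ c (bordered a b D) else 0) =
      (if D.rank = R then (Fintype.card F : ℂ) ^ (D.rank + 1) * quadSum ψ c D else 0) +
      if D.rank + 2 = R then
        ((Fintype.card F : ℂ) ^ Fintype.card κ - (Fintype.card F : ℂ) ^ D.rank) *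
          (Fintype.card F : ℂ) * quadSum ψ c D else 0 := by
  have hq : (Fintype.card F : ℂ) ≠ 0 := by simp
  have h := sum_border_quadSum hψ h2 hc 0 R hD
  have h0 : quadSum ψ 0 D = (Fintype.card F : ℂ) ^ Fintype.card κ := by simp [quadSum]
  simp only [zero_mul, AddChar.map_zero_eq_one, mul_one] at h
  rw [h, h0]
  congr 1
  · have h3 : (∑ u : F, if D.rank + (if u = 0 then 0 else 1) = R then
        ∑ s, ψ (c * u * s ^ 2) else 0) = if D.rank = R then (Fintype.card F : ℂ) else 0 := by
      have h4 := sum_sum_addChar_mul_sq hψ c 0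
      have h5 : (Finset.univ.filter fun s : F => c * s ^ 2 + 0 = 0) = {0} := by
        ext s
        simp [hc]
      simp only [zero_mul, AddChar.map_zero_eq_one, mul_one, h5, Finset.card_singleton,
        Nat.cast_one] at h4
      rw [Fintype.sum_eq_add_sum_compl 0] at h4 ⊢
      have h6 : ∑ u ∈ ({0}ᶜ : Finset F), ∑ s, ψ (c * u * s ^ 2) = 0 := by
        simpa using h4
      rw [Finset.sum_congr rfl (s₁ := {0}ᶜ) (g := fun u => if D.rank + 1 = R then
        ∑ s, ψ (c * u * s ^ 2) else 0)]
      · rw [Finset.sum_ite_irrel, h6]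
        simp
      · intro u hu
        simp only [Finset.mem_compl, Finset.mem_singleton] at hu
        simp [hu]
    rw [h3]
    split_ifs
    · field_simp
      ring
    · simp
  · simp only [Finset.sum_const, Finset.card_univ, nsmul_eq_mul, mul_one]
    congr 1
    ring

theorem norm_sum_border_quadSum_le {ψ : AddChar F ℂ} (hψ : ψ.IsPrimitive) (h2 : (2 : F) ≠ 0)
    {c e : F} (hc : c ≠ 0) (he : e ≠ 0) (R : ℕ) {D : Matrix κ κ F} (hD : D.IsSymm) :
    ‖∑ b : κ → F, ∑ a : F, if (bordered a b D).rank = R then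
        quadSum ψ c (bordered a b D) * ψ (e * a) else 0‖ ≤
      if D.rank = R ∨ D.rank + 1 = R then
        (Fintype.card F : ℝ) ^ (Fintype.card κ + 1) else 0 := by
  have hq : (0 : ℝ) < Fintype.card F := by exact_mod_cast Fintype.card_pos
  have hz : ∑ a, ψ (e * a) = 0 := by rw [sum_addChar_mul hψ, if_neg he]
  rw [sum_border_quadSum hψ h2 hc e R hD, hz, mul_zero, mul_zero, ite_self, add_zero]
  have h3 : ‖∑ u : F, if D.rank + (if u = 0 then 0 else 1) = R then
            (∑ s, ψ (c * u * s ^ 2)) * ψ (e * u) else 0‖ ≤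
      if D.rank = R ∨ D.rank + 1 = R then (Fintype.card F : ℝ) else 0 := by
    have h4 := sum_sum_addChar_mul_sq hψ c e
    rw [Fintype.sum_eq_add_sum_compl 0] at h4 ⊢
    rw [Finset.sum_congr rfl (s₁ := {0}ᶜ) (g := fun u => if D.rank + 1 = R then
      (∑ s, ψ (c * u * s ^ 2)) * ψ (e * u) else 0)]
    · rw [Finset.sum_ite_irrel]
      rcases eq_or_ne D.rank R with h | h
      · simp [h]
      · by_cases h' : D.rank + 1 = R
        · have h6 : ∑ u ∈ ({0}ᶜ : Finset F), (∑ s, ψ (c * u * s ^ 2)) * ψ (e * u) =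
              (Fintype.card F : ℂ) *
                (((Finset.univ.filter fun s : F => c * s ^ 2 + e = 0).card : ℝ) - 1 : ℝ) := by
            simp only [mul_zero, zero_mul, AddChar.map_zero_eq_one, mul_one, Finset.sum_const,
              Finset.card_univ, nsmul_eq_mul] at h4
            push_cast
            linear_combination h4
          simp only [h, h', or_true, if_true, h6]
          have h7 : ((Finset.univ.filter fun s : F => c * s ^ 2 + e = 0).card : ℝ) ≤ 2 := by
            exact_mod_cast card_filter_mul_sq_add_le hc e
          have h8 : (0 : ℝ) ≤ (Finset.univ.filter fun s : F => c * s ^ 2 + e = 0).card := by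
            positivity
          have h9 : |((Finset.univ.filter fun s : F => c * s ^ 2 + e = 0).card : ℝ) - 1| ≤ 1 :=
            abs_le.mpr ⟨by linarith, by linarith⟩
          simp only [add_zero, h, if_false, zero_add, norm_mul, Complex.norm_natCast,
            Complex.norm_real, Real.norm_eq_abs]
          nlinarith
        · simp [h, h']
    · intro u hu
      simp only [Finset.mem_compl, Finset.mem_singleton] at hu
      simp [hu]
  have h5 : ‖quadSum ψ c D‖ * ‖quadSum ψ e D‖ * (Fintype.card F : ℝ) ^ D.rank =
      ((Fintype.card F : ℝ) ^ Fintype.card κ) ^ 2 := by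
    have hce : ‖quadSum ψ c D‖ = ‖quadSum ψ e D‖ := by
      refine (pow_left_inj₀ (norm_nonneg _) (norm_nonneg _) two_ne_zero).mp ?_
      rw [quadSum_normSq hψ h2 hc hD, quadSum_normSq hψ h2 he hD]
    rw [← quadSum_normSq_mul_rank hψ h2 he hD, hce]
    ring
  rw [norm_mul, norm_mul, norm_mul, norm_div, norm_pow, norm_pow, Complex.norm_natCast]
  calc _ = (Fintype.card F : ℝ) ^ Fintype.card κ * ‖∑ u : F,
        if D.rank + (if u = 0 then 0 else 1) = R then
            (∑ s, ψ (c * u * s ^ 2)) * ψ (e * u) else 0‖ := by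
        rw [← mul_assoc]
        congr 1
        rw [div_mul_eq_mul_div, mul_comm, h5, pow_two, mul_div_assoc, div_self (by positivity),
          mul_one]
    _ ≤ (Fintype.card F : ℝ) ^ Fintype.card κ *
        if D.rank = R ∨ D.rank + 1 = R then (Fintype.card F : ℝ) else 0 := by gcongr
    _ = _ := by
        split_ifs
        · rw [pow_succ]
        · simp

/-- Reindexing of symmetric matrices. -/
def SymMat.reindex {κ κ' : Type*} (F : Type*) (e : κ ≃ κ') : SymMat κ F ≃ SymMat κ' F where
  toFun A := ⟨A.1.submatrix e.symm e.symm, A.2.submatrix _⟩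
  invFun A := ⟨A.1.submatrix e e, A.2.submatrix _⟩
  left_inv A := by simp
  right_inv A := by simp

theorem quadSum_submatrix {κ' : Type*} [Fintype κ'] [DecidableEq κ'] (ψ : AddChar F ℂ) (c : F)
    (e : κ' ≃ κ) (D : Matrix κ κ F) : quadSum ψ c (D.submatrix e e) = quadSum ψ c D := by
  unfold quadSum
  rw [← Equiv.sum_comp (Equiv.arrowCongr e.symm (Equiv.refl F))]
  refine Finset.sum_congr rfl fun x _ => ?_
  congr 2
  simp only [submatrix_mulVec_equiv]
  simp only [dotProduct]
  rw [← Equiv.sum_comp e]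
  refine Finset.sum_congr rfl fun i _ => ?_
  simp [Function.comp_def, Equiv.arrowCongr]

/-- The sum of `quadSum` over symmetric matrices of rank exactly `R`. -/
noncomputable def rankQuadSum (κ : Type*) [Fintype κ] [DecidableEq κ] (ψ : AddChar F ℂ) (c : F)
    (R : ℕ) : ℂ :=
  ∑ A : SymMat κ F, if A.1.rank = R then quadSum ψ c A.1 else 0

/-- The number of symmetric matrices whose rank is `R` or `R - 1`. -/
noncomputable def pairCount (κ F : Type*) [Fintype κ] [Field F] [Fintype F] (R : ℕ) : ℂ :=
  ∑ A : SymMat κ F, if A.1.rank = R ∨ A.1.rank + 1 = R then 1 else 0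

theorem rankQuadSum_congr {κ' : Type*} [Fintype κ'] [DecidableEq κ'] (e : κ ≃ κ')
    (ψ : AddChar F ℂ) (c : F) (R : ℕ) : rankQuadSum κ ψ c R = rankQuadSum κ' ψ c R := by
  unfold rankQuadSum
  rw [← Equiv.sum_comp (SymMat.reindex F e)]
  refine Finset.sum_congr rfl fun A _ => ?_
  simp [SymMat.reindex, quadSum_submatrix]

theorem pairCount_congr {κ' : Type*} [Fintype κ'] (e : κ ≃ κ') (R : ℕ) :
    pairCount κ F R = pairCount κ' F R := by
  unfold pairCount
  rw [← Equiv.sum_comp (SymMat.reindex F e)]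
  refine Finset.sum_congr rfl fun A _ => ?_
  simp [SymMat.reindex]

theorem rankQuadSum_unit_sum {ψ : AddChar F ℂ} (hψ : ψ.IsPrimitive) (h2 : (2 : F) ≠ 0) {c : F}
    (hc : c ≠ 0) (t : ℕ) :
    rankQuadSum (Unit ⊕ κ) ψ c (t + 2) =
      (Fintype.card F : ℂ) ^ (t + 3) * rankQuadSum κ ψ c (t + 2) +
      ((Fintype.card F : ℂ) ^ Fintype.card κ - (Fintype.card F : ℂ) ^ t) *
          (Fintype.card F : ℂ) * rankQuadSum κ ψ c t := by
  rw [rankQuadSum, sum_symMat_bordered (F := F) (κ := κ)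
    (fun A => if A.rank = t + 2 then quadSum ψ c A else 0), rankQuadSum, rankQuadSum,
    Finset.mul_sum, Finset.mul_sum, ← Finset.sum_add_distrib]
  refine Finset.sum_congr rfl fun D _ => ?_
  rw [sum_border_quadSum_zero hψ h2 hc _ D.2]
  congr 1
  · split_ifs with h <;> simp [h]
  · simp only [Nat.add_right_cancel_iff]
    split_ifs with h <;> simp [h]

theorem pairCount_unit_sum (h2 : (2 : F) ≠ 0) (t : ℕ) :
    pairCount (Unit ⊕ κ) F (t + 2) =
      (Fintype.card F : ℂ) ^ (t + 2) * pairCount κ F (t + 2) +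
      ((Fintype.card F : ℂ) ^ (Fintype.card κ + 1) - (Fintype.card F : ℂ) ^ t) *
        pairCount κ F t := by
  have hsplit : ∀ (A : Matrix (Unit ⊕ κ) (Unit ⊕ κ) F),
      (if A.rank = t + 2 ∨ A.rank + 1 = t + 2 then (1 : ℂ) else 0) =
      (if A.rank = t + 2 then 1 else 0) + if A.rank = t + 1 then 1 else 0 := by
    intro A
    by_cases h : A.rank = t + 2
    · simp [h]
    · simp [h]
  rw [pairCount, sum_symMat_bordered (F := F) (κ := κ)
    (fun A => if A.rank = t + 2 ∨ A.rank + 1 = t + 2 then 1 else 0), pairCount, pairCount,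
    Finset.mul_sum, Finset.mul_sum, ← Finset.sum_add_distrib]
  refine Finset.sum_congr rfl fun D _ => ?_
  simp_rw [hsplit, Finset.sum_add_distrib]
  rw [sum_border_rank h2 _ D.2, sum_border_rank h2 _ D.2]
  generalize D.1.rank = r
  by_cases h1 : r = t + 2
  · have h3 : ¬ t + 2 + 1 = t := by omega
    simp [h1, h3]
  by_cases h3 : r = t + 1
  · have h4 : ¬ t + 1 + 1 = t := by omega
    simp [h3, h4]
    ring
  by_cases h4 : r = t
  · simp [h4]
    ring
  by_cases h5 : r + 1 = t
  · subst h5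
    simp [h1, h3]
    ring
  · have h6 : ¬ r + 1 = t + 2 := by omega
    have h7 : ¬ r + 2 = t + 2 := by omega
    have h8 : ¬ r + 1 = t + 1 := by omega
    have h9 : ¬ r + 2 = t + 1 := by omega
    simp only [h1, h3, h4, h5, h6, h7, h8, h9]
    simp

theorem matrix_rank_eq_zero_iff (A : Matrix κ κ F) : A.rank = 0 ↔ A = 0 := by
  refine ⟨fun h => ?_, fun h => by rw [h, rank_zero]⟩
  rw [Matrix.rank, Submodule.finrank_eq_zero, LinearMap.range_eq_bot] at h
  ext i j
  simpa using congrFun (DFunLike.congr_fun h (Pi.single j 1)) i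

theorem rankQuadSum_eq_pairCount {ψ : AddChar F ℂ} (hψ : ψ.IsPrimitive) (h2 : (2 : F) ≠ 0)
    {c : F} (hc : c ≠ 0) (t k : ℕ) :
    rankQuadSum (Unit ⊕ Fin k) ψ c (2 * t) =
      (Fintype.card F : ℂ) ^ (k + 1) * pairCount (Fin k) F (2 * t) := by
  have hzero : ∀ {κ' : Type} [Fintype κ'] [DecidableEq κ'] (A : SymMat κ' F),
      A.1.rank = 0 ↔ A = ⟨0, isSymm_zero⟩ := by
    intro κ' _ _ A
    rw [Subtype.ext_iff, matrix_rank_eq_zero_iff]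
  have hbase : ∀ {κ' : Type} [Fintype κ'] [DecidableEq κ'],
      rankQuadSum κ' ψ c 0 = (Fintype.card F : ℂ) ^ Fintype.card κ' ∧ pairCount κ' F 0 = 1 := by
    intro κ' _ _
    constructor
    · simp [rankQuadSum, hzero, quadSum]
    · simp [pairCount, hzero]
  induction k generalizing t with
  | zero =>
    rcases t with _ | t
    · simp [hbase]
    · have h := rankQuadSum_unit_sum (κ := Fin 0) hψ h2 hc (2 * t)
      have hr : ∀ A : Matrix (Fin 0) (Fin 0) F, A.rank = 0 := fun A => by
        simpa using A.rank_le_card_height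
      rw [Nat.mul_succ, h]
      rcases t with _ | t
      · simp [rankQuadSum, pairCount, hr]
      · simp [rankQuadSum, pairCount, hr]
  | succ k ih =>
    have e : Unit ⊕ Fin k ≃ Fin (k + 1) := Fintype.equivFinOfCardEq (by simp [add_comm])
    rcases t with _ | t
    · simp [hbase, add_comm]
    · rw [Nat.mul_succ, rankQuadSum_unit_sum hψ h2 hc, ← rankQuadSum_congr e,
        ← rankQuadSum_congr e, ← pairCount_congr e, pairCount_unit_sum h2, ih,
        show 2 * t + 2 = 2 * (t + 1) by ring, ih]
      simp only [Fintype.card_fin]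
      ring

theorem norm_sum_rank_quadSum_le {ψ : AddChar F ℂ} (hψ : ψ.IsPrimitive) (h2 : (2 : F) ≠ 0)
    {c e : F} (hc : c ≠ 0) (he : e ≠ 0) (R : ℕ) (φ : Matrix κ κ F → ℂ) (hφ : ∀ D, ‖φ D‖ = 1) :
    ‖∑ B : SymMat (Unit ⊕ κ) F, if B.1.rank = R then
        quadSum ψ c B.1 * (ψ (e * B.1 (.inl ()) (.inl ())) * φ B.1.toBlocks₂₂) else 0‖ ≤
      ((Fintype.card F : ℂ) ^ (Fintype.card κ + 1) * pairCount κ F R).re := by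
  rw [sum_symMat_bordered (F := F) (κ := κ) (fun B => if B.rank = R then
        quadSum ψ c B * (ψ (e * B (.inl ()) (.inl ())) * φ B.toBlocks₂₂) else 0)]
  have h : ((Fintype.card F : ℂ) ^ (Fintype.card κ + 1) * pairCount κ F R).re =
      ∑ D : SymMat κ F, if D.1.rank = R ∨ D.1.rank + 1 = R then
        (Fintype.card F : ℝ) ^ (Fintype.card κ + 1) else 0 := by
    rw [← Complex.ofReal_re (∑ D : SymMat κ F, _)]
    congr 1
    rw [pairCount, Finset.mul_sum]
    push_cast
    refine Finset.sum_congr rfl fun D _ => ?_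
    split_ifs <;> simp
  rw [h]
  refine (norm_sum_le _ _).trans (Finset.sum_le_sum fun D _ => ?_)
  refine le_trans (le_of_eq ?_) (norm_sum_border_quadSum_le hψ h2 hc he R D.2)
  have h1 : ∀ (a : F) (b : κ → F), (bordered a b D.1).toBlocks₂₂ = D.1 :=
    fun a b => toBlocks_fromBlocks₂₂ _ _ _ _
  have h3 : ∀ (a : F) (b : κ → F), bordered a b D.1 (.inl ()) (.inl ()) = a := fun a b => rfl
  symm
  rw [← mul_one ‖∑ b : κ → F, _‖, ← hφ D.1, ← norm_mul, Finset.sum_mul]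
  congr 1
  refine Finset.sum_congr rfl fun b _ => ?_
  rw [Finset.sum_mul]
  refine Finset.sum_congr rfl fun a _ => ?_
  rw [h1, h3, ite_mul, zero_mul, mul_assoc]

/-- The character sum over symmetric matrices of rank at most `R` attached to the diagonal linear
form with coefficients `d`. -/
noncomputable def diagCharSum (ψ : AddChar F ℂ) (R : ℕ) (d : κ → F) : ℂ :=
  ∑ A : SymMat κ F, if A.1.rank ≤ R then ψ (∑ i, d i * A.1 i i) else 0

theorem diagCharSum_unit_sum {ψ : AddChar F ℂ} (hψ : ψ.IsPrimitive) (h2 : (2 : F) ≠ 0) (R : ℕ)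
    {d : Unit ⊕ κ → F} (hd : d (.inl ()) ≠ 0) :
    diagCharSum ψ R d = (Fintype.card F : ℂ) ^ R / (Fintype.card F : ℂ) ^ Fintype.card κ *
      ∑ B : SymMat κ F, if B.1.rank = R then
        quadSum ψ (d (.inl ())) B.1 * ψ (∑ i, d (.inr i) * B.1 i i) else 0 := by
  rw [diagCharSum, sum_symMat_bordered (F := F) (κ := κ)
    (fun A => if A.rank ≤ R then ψ (∑ i, d i * A i i) else 0), Finset.mul_sum]
  refine Finset.sum_congr rfl fun B _ => ?_
  have h : ∀ (a : F) (b : κ → F), ∑ i, d i * bordered a b B.1 i i =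
      d (.inl ()) * a + ∑ i, d (.inr i) * B.1 i i := by
    intro a b
    simp [Fintype.sum_sum_type, bordered]
  simp_rw [h, AddChar.map_add_eq_mul]
  have h3 := sum_border_addChar hψ h2 hd R B.2
  calc _ = (∑ b : κ → F, ∑ a : F, if (bordered a b B.1).rank ≤ R then
        ψ (d (.inl ()) * a) else 0) * ψ (∑ i, d (.inr i) * B.1 i i) := by
        simp_rw [Finset.sum_mul, ite_mul, zero_mul]
    _ = _ := by
        rw [h3]
        split_ifs
        · ring
        · simp

theorem re_diagCharSum_le {ψ : AddChar F ℂ} (hψ : ψ.IsPrimitive) (h2 : (2 : F) ≠ 0) (t k : ℕ)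
    {d : Unit ⊕ (Unit ⊕ Fin k) → F} (hd : d (.inl ()) ≠ 0) (hd' : d (.inr (.inl ())) ≠ 0)
    {c : F} (hc : c ≠ 0) :
    (diagCharSum ψ (2 * t) d).re ≤
      (diagCharSum ψ (2 * t) (Pi.single (.inl ()) c : Unit ⊕ (Unit ⊕ Fin k) → F)).re := by
  have hq : (0 : ℝ) < Fintype.card F := by exact_mod_cast Fintype.card_pos
  rw [diagCharSum_unit_sum hψ h2 _ hd, diagCharSum_unit_sum hψ h2 _ (by simpa using hc)]
  have hK : ((Fintype.card F : ℂ) ^ (2 * t) /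
      (Fintype.card F : ℂ) ^ Fintype.card (Unit ⊕ Fin k)) =
      (((Fintype.card F : ℝ) ^ (2 * t) /
      (Fintype.card F : ℝ) ^ Fintype.card (Unit ⊕ Fin k) : ℝ) : ℂ) := by
    push_cast
    rfl
  rw [hK, Complex.re_ofReal_mul, Complex.re_ofReal_mul]
  refine mul_le_mul_of_nonneg_left ?_ (by positivity)
  have h1 : (∑ B : SymMat (Unit ⊕ Fin k) F, if B.1.rank = 2 * t then
      quadSum ψ ((Pi.single (.inl ()) c : Unit ⊕ (Unit ⊕ Fin k) → F) (.inl ())) B.1 *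
        ψ (∑ i, (Pi.single (.inl ()) c : Unit ⊕ (Unit ⊕ Fin k) → F) (.inr i) * B.1 i i) else 0) =
      (Fintype.card F : ℂ) ^ (k + 1) * pairCount (Fin k) F (2 * t) := by
    rw [← rankQuadSum_eq_pairCount hψ h2 hc t k]
    simp [rankQuadSum]
  rw [h1]
  refine (Complex.re_le_norm _).trans ?_
  have h3 := norm_sum_rank_quadSum_le hψ h2 hd hd' (2 * t)
    (fun D : Matrix (Fin k) (Fin k) F => ψ (∑ i, d (.inr (.inr i)) * D i i))
    (fun D => ψ.norm_apply _)
  simp only [Fintype.card_fin, ← AddChar.map_add_eq_mul] at h3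
  simpa [Fintype.sum_sum_type, toBlocks₂₂, of_apply] using h3

/-- The weight of the codeword of the diagonal linear form with coefficients `d`. -/
noncomputable def diagWeight (R : ℕ) (d : κ → F) : ℕ :=
  Nat.card {A : Matrix κ κ F // A.IsSymm ∧ A.rank ≤ R ∧ ∑ i, d i * A i i ≠ 0}

theorem diagWeight_comp {κ' : Type*} [Fintype κ'] [DecidableEq κ'] (e : κ' ≃ κ) (R : ℕ)
    (d : κ → F) : diagWeight R (d ∘ e) = diagWeight R d := by
  refine Nat.card_congr ((Matrix.reindex e e).subtypeEquiv fun A => ?_)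
  rw [← Equiv.sum_comp e]
  have h : (Matrix.reindex e e A).IsSymm ↔ A.IsSymm := by
    refine ⟨fun h => ?_, fun h => h.submatrix _⟩
    have := h.submatrix e
    simpa using this
  rw [h, Matrix.rank_reindex]
  simp

theorem diagWeight_smul (R : ℕ) {c : F} (hc : c ≠ 0) (d : κ → F) :
    diagWeight R (c • d) = diagWeight R d := by
  refine Nat.card_congr (Equiv.subtypeEquivRight fun A => ?_)
  simp [mul_assoc, ← Finset.mul_sum, hc]

theorem sum_diagCharSum {ψ : AddChar F ℂ} (hψ : ψ.IsPrimitive) (R : ℕ) (d : κ → F) :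
    ∑ c : F, diagCharSum ψ R (c • d) = (Fintype.card F : ℂ) *
      ((∑ A : SymMat κ F, if A.1.rank ≤ R then 1 else 0) - diagWeight R d) := by
  have hw : (diagWeight R d : ℂ) = ∑ A : SymMat κ F,
      if A.1.rank ≤ R ∧ ∑ i, d i * A.1 i i ≠ 0 then 1 else 0 := by
    rw [← Finset.sum_filter, Finset.sum_const, nsmul_eq_mul, mul_one, ← Fintype.card_subtype,
      ← Nat.card_eq_fintype_card]
    congr 1
    exact (Nat.card_congr (Equiv.subtypeSubtypeEquivSubtypeInter
      (fun A : Matrix κ κ F => A.IsSymm)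
      (fun A => A.rank ≤ R ∧ ∑ i, d i * A i i ≠ 0))).symm
  rw [hw, ← Finset.sum_sub_distrib, Finset.mul_sum]
  unfold diagCharSum
  rw [Finset.sum_comm]
  refine Finset.sum_congr rfl fun A _ => ?_
  have h : ∀ c : F, ∑ i, (c • d) i * A.1 i i = (∑ i, d i * A.1 i i) * c := by
    intro c
    rw [Finset.sum_mul]
    exact Finset.sum_congr rfl fun i _ => by simp; ring
  simp_rw [h, Finset.sum_ite_irrel, sum_addChar_mul hψ]
  by_cases h1 : A.1.rank ≤ R <;> by_cases h3 : ∑ i, d i * A.1 i i = 0 <;> simp [h1, h3]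

theorem diagWeight_le {ψ : AddChar F ℂ} (hψ : ψ.IsPrimitive) (R : ℕ) {d e : κ → F}
    (h : ∀ c : F, c ≠ 0 → (diagCharSum ψ R (c • d)).re ≤ (diagCharSum ψ R (c • e)).re) :
    diagWeight R e ≤ diagWeight R d := by
  have hq : (0 : ℝ) < Fintype.card F := by exact_mod_cast Fintype.card_pos
  have h1 : (∑ c : F, diagCharSum ψ R (c • d)).re ≤ (∑ c : F, diagCharSum ψ R (c • e)).re := by
    rw [Complex.re_sum, Complex.re_sum]
    refine Finset.sum_le_sum fun c _ => ?_
    rcases eq_or_ne c 0 with rfl | hc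
    · simp
    · exact h c hc
  rw [sum_diagCharSum hψ, sum_diagCharSum hψ, ← Complex.ofReal_natCast, Complex.re_ofReal_mul,
    Complex.re_ofReal_mul, mul_le_mul_iff_right₀ hq, Complex.sub_re, Complex.sub_re,
    Complex.natCast_re, Complex.natCast_re] at h1
  have h3 : (diagWeight R e : ℝ) ≤ diagWeight R d := by linarith
  exact_mod_cast h3

theorem exists_equiv_apply_eq {α β : Type*} [DecidableEq β] (e : α ≃ β) {x y : α} (hxy : x ≠ y)
    {i j : β} (hij : i ≠ j) : ∃ e' : α ≃ β, e' x = i ∧ e' y = j := by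
  let e₁ := e.trans (Equiv.swap (e x) i)
  have h1 : e₁ x = i := by simp [e₁]
  refine ⟨e₁.trans (Equiv.swap (e₁ y) j), ?_, by simp⟩
  rw [Equiv.trans_apply, h1]
  refine Equiv.swap_apply_of_ne_of_ne ?_ hij
  rw [← h1]
  exact e₁.injective.ne hxy

theorem diagWeight_single_eq (R : ℕ) (i j : κ) :
    diagWeight R (Pi.single i 1 : κ → F) = diagWeight R (Pi.single j 1 : κ → F) := by
  rw [← diagWeight_comp (Equiv.swap i j)]
  congr 1
  ext x
  simp [Pi.single_apply, Equiv.swap_apply_eq_iff]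

theorem diagWeight_single_le (h2 : (2 : F) ≠ 0) (t : ℕ) (i₀ : κ) {d : κ → F} (hd : d ≠ 0) :
    diagWeight (2 * t) (Pi.single i₀ 1 : κ → F) ≤ diagWeight (2 * t) d := by
  obtain ⟨i, hi⟩ := Function.ne_iff.mp hd
  rw [diagWeight_single_eq _ i₀ i]
  by_cases h : ∃ j, i ≠ j ∧ d j ≠ 0
  · obtain ⟨j, hij, hj⟩ := h
    obtain ⟨k, hk⟩ : ∃ k, Fintype.card κ = k + 2 :=
      Nat.exists_eq_add_of_le' (Fintype.one_lt_card_iff.mpr ⟨i, j, hij⟩)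
    have e₀ : Unit ⊕ (Unit ⊕ Fin k) ≃ κ := Fintype.equivOfCardEq (by simp [hk]; omega)
    obtain ⟨e, he, he'⟩ := exists_equiv_apply_eq e₀ (x := .inl ()) (y := .inr (.inl ()))
      (by simp) hij
    rw [← diagWeight_comp e _ (Pi.single i 1), ← diagWeight_comp e _ d]
    obtain ⟨ψ, hψ⟩ := exists_isPrimitive (F := F)
    refine diagWeight_le hψ _ fun c hc => ?_
    have h3 : c • ((Pi.single i 1 : κ → F) ∘ e) = Pi.single (.inl ()) c := by
      ext x
      simp [Pi.single_apply, ← he]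
    rw [h3]
    refine re_diagCharSum_le hψ h2 t k ?_ ?_ hc
    · simpa [he, hc] using hi
    · simpa [he', hc] using hj
  · push Not at h
    have h3 : d = d i • Pi.single i 1 := by
      ext x
      rcases eq_or_ne i x with rfl | hx
      · simp
      · simp [h x hx, hx.symm]
    rw [h3, diagWeight_smul _ hi]

theorem exists_congruent_diagonal (h2 : (2 : F) ≠ 0) {S : Matrix κ κ F} (hS : S.IsSymm) :
    ∃ (P : Matrix κ κ F) (d : κ → F), IsUnit P ∧ Pᵀ * S * P = diagonal d := by
  have : Invertible (2 : F) := invertibleOfNonzero h2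
  have hB : LinearMap.IsSymm (Matrix.toBilin' S) := by
    refine ⟨fun x y => ?_⟩
    rw [RingHom.id_apply, Matrix.toBilin'_apply', Matrix.toBilin'_apply',
      dotProduct_mulVec_comm hS]
  obtain ⟨v, hv⟩ := LinearMap.BilinForm.exists_orthogonal_basis hB
  have e : Fin (Module.finrank F (κ → F)) ≃ κ := Fintype.equivOfCardEq (by simp)
  let w := v.reindex e
  refine ⟨(Pi.basisFun F κ).toMatrix w, fun i => S.toBilin' (w i) (w i), ?_, ?_⟩
  · have := (Pi.basisFun F κ).invertibleToMatrix w
    exact isUnit_of_invertible _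
  · have h := LinearMap.BilinForm.toMatrix_mul_basis_toMatrix (Pi.basisFun F κ) w
      (Matrix.toBilin' S)
    have h3 : LinearMap.BilinForm.toMatrix (Pi.basisFun F κ) (Matrix.toBilin' S) = S := by
      rw [LinearMap.BilinForm.toMatrix_basisFun, LinearMap.BilinForm.toMatrix'_toBilin']
    rw [h3] at h
    rw [h]
    ext i j
    rw [LinearMap.BilinForm.toMatrix_apply, diagonal_apply]
    split_ifs with hij
    · rw [hij]
    · simpa [w] using hv (e.symm.injective.ne hij)

theorem sum_sum_mul_eq_trace {C A : Matrix κ κ F} (h2 : (2 : F) ≠ 0) (hA : A.IsSymm) :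
    ∑ i, ∑ j, C i j * A i j = (((2 : F)⁻¹ • (C + Cᵀ)) * A).trace := by
  have h1 : (C * A).trace = ∑ i, ∑ j, C i j * A i j := by
    simp only [trace, diag_apply, mul_apply]
    exact Finset.sum_congr rfl fun i _ => Finset.sum_congr rfl fun j _ => by rw [hA.apply i j]
  have h3 : (Cᵀ * A).trace = (C * A).trace := by
    rw [← trace_transpose, transpose_mul, transpose_transpose, hA.eq, trace_mul_comm]
  rw [smul_mul, trace_smul, add_mul, trace_add, h3, h1, smul_eq_mul]
  field_simp
  ring

theorem exists_diagWeight_eq (h2 : (2 : F) ≠ 0) (R : ℕ) (C : Matrix κ κ F) :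
    ∃ d : κ → F, Nat.card {A : Matrix κ κ F // A.IsSymm ∧ A.rank ≤ R ∧
      ∑ i, ∑ j, C i j * A i j ≠ 0} = diagWeight R d := by
  have hS : ((2 : F)⁻¹ • (C + Cᵀ)).IsSymm := by
    rw [Matrix.IsSymm, transpose_smul, transpose_add, transpose_transpose, add_comm]
  obtain ⟨P, d, hP, hd⟩ := exists_congruent_diagonal h2 hS
  refine ⟨d, ?_⟩
  lift P to (Matrix κ κ F)ˣ using hP
  have hPi : (P : Matrix κ κ F) * (P⁻¹ : (Matrix κ κ F)ˣ) = 1 := P.mul_inv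
  have hPi' : ((P⁻¹ : (Matrix κ κ F)ˣ) : Matrix κ κ F) * P = 1 := P.inv_mul
  have hPt : (P : Matrix κ κ F)ᵀ * ((P⁻¹ : (Matrix κ κ F)ˣ) : Matrix κ κ F)ᵀ = 1 := by
    rw [← transpose_mul, hPi', transpose_one]
  have hPt' : ((P⁻¹ : (Matrix κ κ F)ˣ) : Matrix κ κ F)ᵀ * (P : Matrix κ κ F)ᵀ = 1 := by
    rw [← transpose_mul, hPi, transpose_one]
  let E : Matrix κ κ F ≃ Matrix κ κ F :=
    { toFun := fun A => P * A * (P : Matrix κ κ F)ᵀ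
      invFun := fun A => (P⁻¹ : (Matrix κ κ F)ˣ) * A * ((P⁻¹ : (Matrix κ κ F)ˣ) : Matrix κ κ F)ᵀ
      left_inv := fun A => by
        simp only [Matrix.mul_assoc, hPt]
        rw [← Matrix.mul_assoc, hPi', Matrix.mul_one, Matrix.one_mul]
      right_inv := fun A => by
        simp only [Matrix.mul_assoc, hPt']
        rw [← Matrix.mul_assoc, hPi, Matrix.mul_one, Matrix.one_mul] }
  refine (Nat.card_congr (E.subtypeEquiv fun A => ?_)).symm
  have hsymm : (E A).IsSymm ↔ A.IsSymm := by
    have hT : (E A)ᵀ = E Aᵀ := by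
      simp [E, transpose_mul, Matrix.mul_assoc]
    rw [Matrix.IsSymm, hT, E.apply_eq_iff_eq, Matrix.IsSymm]
  have hrank : (E A).rank = A.rank := by
    have h1 : IsUnit (P : Matrix κ κ F).det := (isUnit_iff_isUnit_det _).mp P.isUnit
    have h3 : IsUnit (P : Matrix κ κ F)ᵀ.det := by rwa [det_transpose]
    simp only [E, Equiv.coe_fn_mk]
    rw [rank_mul_eq_left_of_isUnit_det _ _ h3, rank_mul_eq_right_of_isUnit_det _ _ h1]
  rw [hsymm, hrank]
  refine and_congr_right fun hA => and_congr_right fun _ => not_congr ?_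
  rw [sum_sum_mul_eq_trace h2 (hsymm.mpr hA)]
  have htr : (((2 : F)⁻¹ • (C + Cᵀ)) * E A).trace = ∑ i, d i * A i i := by
    simp only [E, Equiv.coe_fn_mk]
    rw [← Matrix.mul_assoc, trace_mul_comm, ← Matrix.mul_assoc, ← Matrix.mul_assoc, hd]
    simp [trace, diagonal_mul]
  rw [htr]

theorem diagWeight_single_le_card (h2 : (2 : F) ≠ 0) (t : ℕ) (i₀ : κ) (C : Matrix κ κ F)
    (hC : ∃ A : Matrix κ κ F, A.IsSymm ∧ A.rank ≤ 2 * t ∧ ∑ i, ∑ j, C i j * A i j ≠ 0) :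
    diagWeight (2 * t) (Pi.single i₀ 1 : κ → F) ≤
      Nat.card {A : Matrix κ κ F // A.IsSymm ∧ A.rank ≤ 2 * t ∧
        ∑ i, ∑ j, C i j * A i j ≠ 0} := by
  obtain ⟨d, hd⟩ := exists_diagWeight_eq h2 (2 * t) C
  rw [hd]
  refine diagWeight_single_le h2 t i₀ ?_
  rintro rfl
  have h0 : diagWeight (2 * t) (0 : κ → F) = 0 := by simp [diagWeight]
  rw [h0, Finite.card_eq_zero_iff] at hd
  obtain ⟨A, hA⟩ := hC
  exact hd.false ⟨A, hA⟩

end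

/-- For `q` odd and `2t ≤ m`: for every `1 ≤ k ≤ m` and `δ ≠ 0`, the number of symmetric
matrices `A` of rank at most `2t` with `f_k^δ(A) = A₁₁ + ⋯ + A_{k−1,k−1} + δ A_{kk} ≠ 0` is at
least the number with `A₁₁ ≠ 0`; consequently, every nonzero codeword of the code obtained by
evaluating linear forms `f(A) = Σ C_{ij} A_{ij}` on all symmetric matrices of rank at most
`2t` has weight at least that of the codeword of `X₁₁`, i.e. the minimum distance equals the
weight of the codeword of `X₁₁`. -/
theorem min_distance_even_rank (F : Type*) [Field F] [Fintype F]
    (hq : Odd (Fintype.card F)) (m t : ℕ) (ht : 1 ≤ t) (htm : 2 * t ≤ m) :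
    (∀ (k : ℕ) (hk1 : 1 ≤ k) (hk2 : k ≤ m) (δ : F) (_hδ : δ ≠ 0),
      Nat.card {A : Matrix (Fin m) (Fin m) F // A.IsSymm ∧ A.rank ≤ 2 * t ∧
        (∑ i : Fin (k - 1), A ⟨i.val, by omega⟩ ⟨i.val, by omega⟩) +
          δ * A ⟨k - 1, by omega⟩ ⟨k - 1, by omega⟩ ≠ 0} ≥
      Nat.card {A : Matrix (Fin m) (Fin m) F // A.IsSymm ∧ A.rank ≤ 2 * t ∧
        A ⟨0, by omega⟩ ⟨0, by omega⟩ ≠ 0}) ∧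
    (∀ C : Matrix (Fin m) (Fin m) F,
      (∃ A : Matrix (Fin m) (Fin m) F, A.IsSymm ∧ A.rank ≤ 2 * t ∧
        ∑ i : Fin m, ∑ j : Fin m, C i j * A i j ≠ 0) →
      Nat.card {A : Matrix (Fin m) (Fin m) F // A.IsSymm ∧ A.rank ≤ 2 * t ∧
        ∑ i : Fin m, ∑ j : Fin m, C i j * A i j ≠ 0} ≥
      Nat.card {A : Matrix (Fin m) (Fin m) F // A.IsSymm ∧ A.rank ≤ 2 * t ∧
        A ⟨0, by omega⟩ ⟨0, by omega⟩ ≠ 0}) := by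
  classical
  have h2 : (2 : F) ≠ 0 := by
    refine Ring.two_ne_zero fun h => ?_
    rw [← Nat.not_even_iff_odd, Nat.even_iff] at hq
    exact hq (FiniteField.even_card_of_char_two h)
  have hsingle : Nat.card {A : Matrix (Fin m) (Fin m) F // A.IsSymm ∧ A.rank ≤ 2 * t ∧
      A ⟨0, by omega⟩ ⟨0, by omega⟩ ≠ 0} =
      diagWeight (2 * t) (Pi.single ⟨0, by omega⟩ 1 : Fin m → F) := by
    simp [diagWeight, Pi.single_apply]
  refine ⟨fun k hk1 hk2 δ hδ => hsingle.trans_le ?_,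
    fun C hC => hsingle.trans_le <| diagWeight_single_le_card h2 t _ C hC⟩
  obtain ⟨n, rfl⟩ := Nat.exists_eq_add_of_le' hk1
  obtain ⟨l, rfl⟩ := Nat.exists_eq_add_of_le hk2
  let d : Fin (n + 1 + l) → F := Fin.append (Fin.snoc (fun _ : Fin n => (1 : F)) δ) 0
  have hd : d ≠ 0 := by
    intro h
    have h3 := congrFun h (Fin.castAdd l (Fin.last n))
    simp only [d, Fin.append_left, Fin.snoc_last] at h3
    exact hδ h3
  refine (diagWeight_single_le h2 t _ hd).trans_eq
    (Nat.card_congr (Equiv.subtypeEquivRight fun A => ?_))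
  have h3 : ∑ i, d i * A i i = (∑ i : Fin n, A ⟨i.val, by omega⟩ ⟨i.val, by omega⟩) +
      δ * A ⟨n, by omega⟩ ⟨n, by omega⟩ := by
    rw [Fin.sum_univ_add, Fin.sum_univ_castSucc]
    simp [d]
    rfl
  rw [h3]
  rfl
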